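/- arXiv:1702.00973 — 3 statements merged into one kernel-verified Lean document; each statement's English description precedes it below -/
import Mathlib

section
/- For all natural numbers r, n, δ ≥ 2, there exist a natural number d with d > δ and a finite d-regular simple graph G such that χ(G) = n and the r-dynamic chromatic number satisfies χ_r(G) = r·χ(G) = r·n. -/
open SimpleGraph

/-- `c` is an `r`-dynamic colouring of `G` with colour set `[t] = {0, …, t-1}`:
a proper colouring such that at least `min r (deg v)` colours are used on the
neighbourhood of every vertex `v`. -/
def IsDynamicColoring {V : Type*} (G : SimpleGraph V) (r t : ℕ) (c : V → ℕ) : Prop :=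
  (∀ v, c v < t) ∧ (∀ u v, G.Adj u v → c u ≠ c v) ∧
    ∀ v : V, min r (G.neighborSet v).ncard ≤ (c '' G.neighborSet v).ncard

/-- The `r`-dynamic chromatic number `χ_r(G)`: the least `t` admitting an
`r`-dynamic colouring with `t` colours. -/
noncomputable def dynChromaticNumber {V : Type*} (G : SimpleGraph V) (r : ℕ) : ℕ :=
  sInf {t | ∃ c : V → ℕ, IsDynamicColoring G r t c}

/-- Two isomorphic graphs have the same `r`-dynamic colourings up to relabelling. -/
lemma IsDynamicColoring.comp_iso {V W : Type*} {G : SimpleGraph V} {H : SimpleGraph W}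
    (e : G ≃g H) {r t : ℕ} {c : W → ℕ} (h : IsDynamicColoring H r t c) :
    IsDynamicColoring G r t (c ∘ e) := by
  obtain ⟨h1, h2, h3⟩ := h
  refine ⟨fun v => h1 _, fun u v huv => h2 _ _ (e.map_rel_iff.2 huv), fun v => ?_⟩
  have himg : e '' G.neighborSet v = H.neighborSet (e v) := by
    ext w
    obtain ⟨u, rfl⟩ := e.surjective w
    simpa [e.injective.mem_set_image] using e.map_rel_iff.symm
  have hv := h3 (e v)
  rwa [← himg, Set.ncard_image_of_injective _ e.injective, ← Set.image_comp] at hv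

lemma dynChromaticNumber_congr {V W : Type*} {G : SimpleGraph V} {H : SimpleGraph W}
    (e : G ≃g H) (r : ℕ) : dynChromaticNumber G r = dynChromaticNumber H r := by
  unfold dynChromaticNumber
  congr 1
  ext t
  exact ⟨fun ⟨c, hc⟩ => ⟨_, hc.comp_iso e.symm⟩, fun ⟨c, hc⟩ => ⟨_, hc.comp_iso e⟩⟩

/-- The number of `k + 1`-subsets of a finite type containing a given element. -/
lemma ncard_setOf_mem_subtype_card {α : Type*} [Fintype α] [DecidableEq α] (k : ℕ) (a : α) :
    {K : {K : Finset α // K.card = k + 1} | a ∈ K.1}.ncard = (Fintype.card α - 1).choose k := by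
  rw [← Set.ncard_image_of_injective _ Subtype.val_injective]
  have h : Subtype.val '' {K : {K : Finset α // K.card = k + 1} | a ∈ K.1} =
      insert a '' (Finset.powersetCard k (Finset.univ.erase a) : Set (Finset α)) := by
    ext K
    simp only [Set.mem_image, Set.mem_ofPred_eq, Subtype.exists, exists_and_right, exists_eq_right,
      Finset.mem_coe, Finset.mem_powersetCard]
    constructor
    · rintro ⟨hK, ha⟩
      refine ⟨K.erase a, ⟨Finset.erase_subset_erase _ (Finset.subset_univ _), ?_⟩,
        Finset.insert_erase ha⟩
      rw [Finset.card_erase_of_mem ha, hK, Nat.add_sub_cancel]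
    · rintro ⟨L, ⟨hL, hcard⟩, rfl⟩
      have haL : a ∉ L := fun ha => by simpa using hL ha
      exact ⟨by rw [Finset.card_insert_of_notMem haL, hcard], Finset.mem_insert_self _ _⟩
  rw [h, Set.InjOn.ncard_image, Set.ncard_coe_finset, Finset.card_powersetCard,
    Finset.card_erase_of_mem (Finset.mem_univ a), Finset.card_univ]
  intro L hL L' hL' hinsert
  rw [Finset.mem_coe, Finset.mem_powersetCard] at hL hL'
  have haL : a ∉ L := fun ha => by simpa using hL.1 ha
  have haL' : a ∉ L' := fun ha => by simpa using hL'.1 ha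
  rw [← Finset.erase_insert haL, ← Finset.erase_insert haL']
  exact congrArg (fun K => K.erase a) hinsert

/-- Vertices of the linked multipartite graph: `Sum.inl (c, i, a)` is the `a`-th vertex in part `i`
of core `c`, and `Sum.inr (x, i, K)` is the `x`-th vertex linking the parts `i` of the cores
in `K`. -/
abbrev LinkedVertex (M n m q : ℕ) : Type :=
  (Fin M × Fin n × Fin m) ⊕ (Fin q × Fin n × {K : Finset (Fin M) // K.card = n})

/-- Adjacency of the linked multipartite graph. -/
def LinkedAdj (M n m q : ℕ) : LinkedVertex M n m q → LinkedVertex M n m q → Prop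
  | .inl (c, i, _), .inl (c', j, _) => c = c' ∧ i ≠ j
  | .inl (c, i, _), .inr (_, j, K) => i = j ∧ c ∈ K.1
  | .inr (_, j, K), .inl (c, i, _) => i = j ∧ c ∈ K.1
  | .inr _, .inr _ => False

/-- `M` disjoint complete `n`-partite graphs (cores) with parts of size `m`, together with, for each
`i` and each set `K` of `n` cores, `q` vertices joined to the `i`-th parts of the cores in `K`. -/
def linkedGraph (M n m q : ℕ) : SimpleGraph (LinkedVertex M n m q) where
  Adj := LinkedAdj M n m q
  symm := ⟨by
    rintro (⟨c, i, a⟩ | ⟨x, i, K⟩) (⟨c', j, b⟩ | ⟨y, j, L⟩) h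
    · exact ⟨h.1.symm, h.2.symm⟩
    · exact h
    · exact h
    · exact h⟩
  loopless := ⟨by
    rintro (⟨c, i, a⟩ | ⟨x, i, K⟩) h
    · exact h.2 rfl
    · exact h⟩

section linkedGraph

variable {M n m q : ℕ}

lemma linkedGraph_neighborSet_inl (c : Fin M) (i : Fin n) (a : Fin m) :
    (linkedGraph M n m q).neighborSet (.inl (c, i, a)) =
      Sum.inl '' ({c} ×ˢ {i}ᶜ ×ˢ Set.univ) ∪ Sum.inr '' (Set.univ ×ˢ {i} ×ˢ {K | c ∈ K.1}) := by
  ext (⟨c', j, b⟩ | ⟨y, j, L⟩) <;>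
    simp [linkedGraph, LinkedAdj, eq_comm]

lemma linkedGraph_neighborSet_inr (x : Fin q) (i : Fin n)
    (K : {K : Finset (Fin M) // K.card = n}) :
    (linkedGraph M n m q).neighborSet (.inr (x, i, K)) =
      Sum.inl '' ((K.1 : Set (Fin M)) ×ˢ {i} ×ˢ Set.univ) := by
  ext (⟨c', j, b⟩ | ⟨y, j, L⟩) <;>
    simp [linkedGraph, LinkedAdj, and_comm]

lemma ncard_linkedGraph_neighborSet (hn : 0 < n) (hm : m = q * (M - 1).choose (n - 1))
    (v : LinkedVertex M n m q) : ((linkedGraph M n m q).neighborSet v).ncard = n * m := by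
  obtain ⟨k, rfl⟩ : ∃ k, n = k + 1 := ⟨n - 1, by omega⟩
  rcases v with ⟨c, i, a⟩ | ⟨x, i, K⟩
  · have hi : ({i}ᶜ : Set (Fin (k + 1))).ncard = k := by
      rw [Set.ncard_compl, Set.ncard_singleton, Nat.card_fin, Nat.add_sub_cancel]
    rw [linkedGraph_neighborSet_inl, Set.ncard_union_eq,
      Set.ncard_image_of_injective _ Sum.inl_injective,
      Set.ncard_image_of_injective _ Sum.inr_injective]
    · simp only [Set.ncard_prod, Set.ncard_singleton, Set.ncard_univ, Nat.card_fin,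
        ncard_setOf_mem_subtype_card, hi, Fintype.card_fin]
      rw [Nat.add_sub_cancel] at hm
      rw [one_mul, one_mul, ← hm]
      ring
    · rw [Set.disjoint_left]
      rintro _ ⟨_, _, rfl⟩ ⟨_, _, h⟩
      cases h
  · rw [linkedGraph_neighborSet_inr, Set.ncard_image_of_injective _ Sum.inl_injective]
    simp [Set.ncard_prod, K.2]

lemma chromaticNumber_linkedGraph (hn : 2 ≤ n) (hM : 0 < M) (hm : 0 < m) :
    (linkedGraph M n m q).chromaticNumber = n := by
  have : NeZero n := ⟨by omega⟩
  have hn1 : n ≠ 1 := by omega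
  apply le_antisymm
  · refine chromaticNumber_le_iff_colorable.2
      ⟨Coloring.mk (fun v => Sum.elim (fun p => p.2.1) (fun p => p.2.1 + 1) v) ?_⟩
    rintro (⟨c, i, a⟩ | ⟨x, i, K⟩) (⟨c', j, b⟩ | ⟨y, j, L⟩) h
    · exact h.2
    · obtain rfl : i = j := h.1
      simp [hn1]
    · obtain rfl : j = i := h.1
      simp [hn1]
    · exact h.elim
  · let f : completeGraph (Fin n) →g linkedGraph M n m q :=
      ⟨fun i => .inl (⟨0, hM⟩, i, ⟨0, hm⟩), fun h => ⟨rfl, h⟩⟩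
    simpa using chromaticNumber_mono_of_hom f

/-- Every part of every core can be given `r` private colours. -/
lemma exists_isDynamicColoring_linkedGraph (r : ℕ) (hr : 0 < r) (hn : 2 ≤ n) (hrm : r ≤ m) :
    ∃ c, IsDynamicColoring (linkedGraph M n m q) r (r * n) c := by
  have : NeZero n := ⟨by omega⟩
  have hn1 : n ≠ 1 := by omega
  have hlt : ∀ (i : Fin n) (j : ℕ), j < r → r * i.1 + j < r * n := fun i j hj => by
    have := Nat.mul_le_mul_left r (Nat.succ_le_of_lt i.2)
    rw [Nat.mul_succ] at this
    omega
  have hdiv : ∀ (i j : ℕ), j < r → (r * i + j) / r = i := fun i j hj => by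
    rw [Nat.mul_add_div hr, Nat.div_eq_of_lt hj, add_zero]
  let col : LinkedVertex M n m q → ℕ :=
    Sum.elim (fun p => r * p.2.1.1 + p.2.2.1 % r) (fun p => r * (p.2.1 + 1 : Fin n).1 + 0)
  have hpart : ∀ (S : Set (LinkedVertex M n m q)) (c : Fin M) (i : Fin n),
      (∀ a, Sum.inl (c, i, a) ∈ S) → r ≤ (col '' S).ncard := by
    intro S c i hS
    have hsub : (fun j => r * i.1 + j) '' (Finset.range r : Set ℕ) ⊆ col '' S := by
      rintro _ ⟨j, hj, rfl⟩
      rw [Finset.mem_coe, Finset.mem_range] at hj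
      exact ⟨_, hS ⟨j, hj.trans_le hrm⟩, by simp [col, Nat.mod_eq_of_lt hj]⟩
    have := Set.ncard_le_ncard hsub
    rwa [Set.ncard_image_of_injective _ (add_right_injective _), Set.ncard_coe_finset,
      Finset.card_range] at this
  refine ⟨col, ?_, ?_, ?_⟩
  · rintro (⟨c, i, a⟩ | ⟨x, i, K⟩)
    · exact hlt _ _ (Nat.mod_lt _ hr)
    · exact hlt _ _ hr
  · rintro (⟨c, i, a⟩ | ⟨x, i, K⟩) (⟨c', j, b⟩ | ⟨y, j, L⟩) h hcol <;>
      have hcol' := congrArg (· / r) hcol <;>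
      simp only [col, Sum.elim_inl, Sum.elim_inr, hdiv _ _ (Nat.mod_lt _ hr), hdiv _ _ hr,
        Fin.val_inj] at hcol'
    · exact h.2 hcol'
    · obtain rfl : i = j := h.1
      simp [hn1] at hcol'
    · obtain rfl : j = i := h.1
      simp [hn1] at hcol'
    · exact h
  · rintro (⟨c, i, a⟩ | ⟨x, i, K⟩) <;> refine (min_le_left _ _).trans ?_
    · exact hpart _ c (i + 1) fun b => ⟨rfl, by simp [hn1]⟩
    · obtain ⟨c, hc⟩ : K.1.Nonempty := Finset.card_pos.1 (by rw [K.2]; omega)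
      exact hpart _ c i fun b => ⟨rfl, hc⟩

/-- With many cores, `n` of them use the same colour sets on their parts; if fewer than `r * n`
colours are used then some part of these cores has fewer than `r` colours. -/
lemma le_of_isDynamicColoring_linkedGraph {r t : ℕ} (hq : 0 < q)
    (hdeg : ∀ v, r ≤ ((linkedGraph M n m q).neighborSet v).ncard) (hn : 0 < n)
    (hM : (2 ^ (r * n)) ^ n * n ≤ M) {col : LinkedVertex M n m q → ℕ}
    (h : IsDynamicColoring (linkedGraph M n m q) r t col) : r * n ≤ t := by
  by_contra! ht
  obtain ⟨hlt, hproper, hdyn⟩ := h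
  let S : Fin M → Fin n → Finset ℕ := fun c i => Finset.univ.image fun a => col (.inl (c, i, a))
  have hS : ∀ c i, S c i ⊆ Finset.range t := fun c i x hx => by
    obtain ⟨a, -, rfl⟩ := Finset.mem_image.1 hx
    exact Finset.mem_range.2 (hlt _)
  obtain ⟨T, hT, hcard⟩ := Finset.exists_le_card_fiber_of_mul_le_card_of_maps_to
    (s := Finset.univ) (t := Fintype.piFinset fun _ : Fin n => (Finset.range (r * n)).powerset)
    (f := S) (n := n)
    (fun c _ => Fintype.mem_piFinset.2 fun i => Finset.mem_powerset.2 <|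
      (hS c i).trans (Finset.range_subset_range.2 ht.le))
    ⟨fun _ => ∅, Fintype.mem_piFinset.2 fun i => Finset.empty_mem_powerset _⟩
    (by simpa using hM)
  obtain ⟨K, hKsub, hK⟩ := Finset.exists_subset_card_eq hcard
  have hKT : ∀ c ∈ K, S c = T := fun c hc => (Finset.mem_filter.1 (hKsub hc)).2
  have hTcard : ∀ i, r ≤ (T i).card := fun i => by
    have hle := hdyn (.inr (⟨0, hq⟩, i, ⟨K, hK⟩))
    rw [min_eq_left (hdeg _)] at hle
    refine hle.trans ?_
    rw [← Set.ncard_coe_finset]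
    refine Set.ncard_le_ncard ?_ (Finset.finite_toSet _)
    rw [linkedGraph_neighborSet_inr]
    rintro _ ⟨_, ⟨⟨c, j, a⟩, ⟨hc, hj, -⟩, rfl⟩, rfl⟩
    obtain rfl : j = i := hj
    rw [← hKT c hc]
    exact Finset.mem_coe.2 (Finset.mem_image_of_mem _ (Finset.mem_univ a))
  obtain ⟨c, hc⟩ : K.Nonempty := Finset.card_pos.1 (by omega)
  have hdisj : Set.PairwiseDisjoint (Finset.univ : Finset (Fin n)) T := by
    intro i _ j _ hij
    rw [Function.onFun, Finset.disjoint_left, ← hKT c hc]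
    intro x hx hx'
    obtain ⟨a, -, rfl⟩ := Finset.mem_image.1 hx
    obtain ⟨b, -, hb⟩ := Finset.mem_image.1 hx'
    exact hproper (.inl (c, i, a)) (.inl (c, j, b)) ⟨rfl, hij⟩ hb.symm
  have hunion : (Finset.univ.biUnion T).card ≤ t := by
    rw [← Finset.card_range t]
    refine Finset.card_le_card (Finset.biUnion_subset.2 fun i _ => ?_)
    rw [← hKT c hc]
    exact hS c i
  rw [Finset.card_biUnion hdisj] at hunion
  have hsum := Finset.card_nsmul_le_sum Finset.univ (fun i => (T i).card) r fun i _ => hTcard i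
  rw [Finset.card_univ, Fintype.card_fin, smul_eq_mul, mul_comm] at hsum
  omega

end linkedGraph

theorem stmt0 (r n δ : ℕ) (hr : 2 ≤ r) (hn : 2 ≤ n) (hδ : 2 ≤ δ) :
    ∃ d : ℕ, δ < d ∧
      ∃ (t : ℕ) (G : SimpleGraph (Fin t)),
        (∀ v, (G.neighborSet v).ncard = d) ∧
        G.chromaticNumber = n ∧
        dynChromaticNumber G r = r * n := by
  obtain ⟨M, hM⟩ : ∃ M, M = (2 ^ (r * n)) ^ n * n := ⟨_, rfl⟩
  have hnM : n ≤ M := hM ▸ Nat.le_mul_of_pos_left n (by positivity)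
  obtain ⟨m, hm⟩ : ∃ m, m = (r + δ) * (M - 1).choose (n - 1) := ⟨_, rfl⟩
  have hle : r + δ ≤ m := hm ▸ Nat.le_mul_of_pos_right _ (Nat.choose_pos (by omega))
  have hmn : m ≤ n * m := Nat.le_mul_of_pos_left m (by omega)
  let e := Fintype.equivFin (LinkedVertex M n m (r + δ))
  let G := linkedGraph M n m (r + δ)
  let φ : G ≃g G.map e.toEmbedding := SimpleGraph.Iso.map e G
  have hreg := ncard_linkedGraph_neighborSet (by omega) hm
  refine ⟨n * m, by omega, _, G.map e.toEmbedding, fun v => ?_, ?_, ?_⟩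
  · obtain ⟨u, rfl⟩ := φ.surjective v
    rw [← hreg u]
    exact (Nat.card_congr (φ.mapNeighborSet u)).symm
  · rw [← (chromaticNumber_mono_of_hom φ.toHom).antisymm
      (chromaticNumber_mono_of_hom φ.symm.toHom)]
    exact chromaticNumber_linkedGraph hn (by omega) (by omega)
  · rw [← dynChromaticNumber_congr φ]
    have hmem := exists_isDynamicColoring_linkedGraph (M := M) (q := r + δ) r (by omega) hn
      (show r ≤ m by omega)
    refine le_antisymm (Nat.sInf_le hmem) (le_csInf ⟨_, hmem⟩ ?_)
    rintro t ⟨c, hc⟩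
    exact le_of_isDynamicColoring_linkedGraph (by omega) (fun v => by rw [hreg v]; omega)
      (by omega) hM.ge hc
end

section
/- For every natural number n ≥ 2, there exists a finite regular simple graph G with χ(G) = n = γ(G), where γ(G) is the minimum chromatic number of a subgraph induced by a total dominating set of G. -/
open SimpleGraph

/-- `D` is a total dominating set: every vertex of `G` has a neighbour in `D`. -/
def IsTotalDominatingSet {V : Type*} (G : SimpleGraph V) (D : Set V) : Prop :=
  ∀ v : V, ∃ u ∈ D, G.Adj v u

/-- `γ(G) := min { χ(G[D]) : D a total dominating set of G }`. -/
noncomputable def gammaTD {V : Type*} (G : SimpleGraph V) : ℕ∞ :=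
  sInf {k | ∃ D : Set V, IsTotalDominatingSet G D ∧ (G.induce D).chromaticNumber = k}

/-- Disjoint complete `n`-partite graphs indexed by `B` with parts of size `m`, together with, for
every part index `i` and every `n`-subset `S` of `B`, a vertex joined to all `i`-th parts of the
graphs indexed by `S`. -/
def blockGraph (B : Type*) (n m : ℕ) :
    SimpleGraph ((B × Fin n × Fin m) ⊕ (Fin n × {S : Finset B // S.card = n})) where
  Adj
    | .inl (b, i, _), .inl (b', i', _) => b = b' ∧ i ≠ i'
    | .inl (b, i, _), .inr (j, S) => i = j ∧ b ∈ S.1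
    | .inr (j, S), .inl (b, i, _) => i = j ∧ b ∈ S.1
    | .inr _, .inr _ => False
  symm := ⟨by
    rintro (⟨b, i, x⟩ | ⟨j, S⟩) (⟨b', i', x'⟩ | ⟨j', S'⟩) h
    · exact ⟨h.1.symm, h.2.symm⟩
    · exact h
    · exact h
    · exact h⟩
  loopless := ⟨by
    rintro (⟨b, i, x⟩ | ⟨j, S⟩) h
    · exact h.2 rfl
    · exact h⟩

/-- The number of `n`-subsets containing a given point does not depend on the point. -/
lemma ncard_subsets_containing_eq {B : Type*} [DecidableEq B] (n : ℕ) (b c : B) :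
    {S : {S : Finset B // S.card = n} | b ∈ S.1}.ncard =
      {S : {S : Finset B // S.card = n} | c ∈ S.1}.ncard := by
  refine Set.ncard_congr
    (fun S _ => ⟨S.1.map (Equiv.swap b c).toEmbedding, by rw [Finset.card_map, S.2]⟩) ?_ ?_ ?_
  · intro S hS
    exact Finset.mem_map.2 ⟨b, hS, Equiv.swap_apply_left b c⟩
  · intro S T _ _ h
    exact Subtype.ext (Finset.map_injective _ (congrArg Subtype.val h))
  · intro S hS
    refine ⟨⟨S.1.map (Equiv.swap b c).toEmbedding, by rw [Finset.card_map, S.2]⟩,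
      Finset.mem_map.2 ⟨c, hS, Equiv.swap_apply_right b c⟩, Subtype.ext ?_⟩
    ext x
    simp [Finset.mem_map_equiv]

lemma ncard_neighborSet_blockGraph {B : Type*} [Finite B] {n m : ℕ}
    (hm : ∀ b : B, {S : {S : Finset B // S.card = n} | b ∈ S.1}.ncard = m)
    (v : (B × Fin n × Fin m) ⊕ (Fin n × {S : Finset B // S.card = n})) :
    ((blockGraph B n m).neighborSet v).ncard = n * m := by
  rcases v with ⟨b, i, x⟩ | ⟨j, S⟩
  · have h : (blockGraph B n m).neighborSet (.inl (b, i, x)) =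
        Sum.inl '' (({b} : Set B) ×ˢ (({i}ᶜ : Set (Fin n)) ×ˢ (Set.univ : Set (Fin m)))) ∪
        Sum.inr '' (({i} : Set (Fin n)) ×ˢ
          {S : {S : Finset B // S.card = n} | b ∈ S.1}) := by
      ext (⟨b', i', x'⟩ | ⟨j, S⟩)
      · simp [blockGraph, eq_comm]
      · simp [blockGraph, eq_comm]
    have hn : 0 < n := i.pos
    rw [h, Set.ncard_union_eq (by
        rw [Set.disjoint_left]
        rintro _ ⟨_, _, rfl⟩ ⟨_, _, h⟩
        cases h),
      Set.ncard_image_of_injective _ Sum.inl_injective,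
      Set.ncard_image_of_injective _ Sum.inr_injective, Set.ncard_prod, Set.ncard_prod,
      Set.ncard_prod, hm, Set.ncard_compl]
    simp only [Set.ncard_singleton, Set.ncard_univ, Nat.card_fin, one_mul]
    rw [Nat.sub_one_mul, Nat.sub_add_cancel (Nat.le_mul_of_pos_left m hn)]
  · have h : (blockGraph B n m).neighborSet (.inr (j, S)) =
        Sum.inl '' ((S.1 : Set B) ×ˢ (({j} : Set (Fin n)) ×ˢ (Set.univ : Set (Fin m)))) := by
      ext (⟨b', i', x'⟩ | ⟨j', S'⟩)
      · simp [blockGraph, and_comm]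
      · simp [blockGraph]
    rw [h, Set.ncard_image_of_injective _ Sum.inl_injective, Set.ncard_prod, Set.ncard_prod,
      Set.ncard_coe_finset, S.2]
    simp

lemma blockGraph_colorable (B : Type*) {n : ℕ} (m : ℕ) (hn : 2 ≤ n) :
    (blockGraph B n m).Colorable n := by
  have : Nontrivial (Fin n) := Fin.nontrivial_iff_two_le.2 hn
  choose g hg using fun i : Fin n => exists_ne i
  refine ⟨Coloring.mk (Sum.elim (fun p => p.2.1) fun p => g p.1) ?_⟩
  rintro (⟨b, i, x⟩ | ⟨j, S⟩) (⟨b', i', x'⟩ | ⟨j', S'⟩) h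
  · exact h.2
  · obtain ⟨rfl, -⟩ := h
    exact (hg i).symm
  · obtain ⟨rfl, -⟩ := h
    exact hg i'
  · exact h.elim

/-- If `B` is large, every total dominating set meets all parts of some complete `n`-partite
block. -/
lemma exists_clique_of_isTotalDominatingSet_blockGraph {B : Type*} [Fintype B] {n m : ℕ}
    (hB : n * (n - 1) < Fintype.card B)
    {D : Set ((B × Fin n × Fin m) ⊕ (Fin n × {S : Finset B // S.card = n}))}
    (hD : IsTotalDominatingSet (blockGraph B n m) D) :
    ∃ f : Fin n → D, Pairwise fun i j => (blockGraph B n m).Adj (f i) (f j) := by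
  classical
  suffices h : ∃ b, ∀ i, ∃ x, Sum.inl (b, i, x) ∈ D by
    obtain ⟨b, hb⟩ := h
    choose x hx using hb
    exact ⟨fun i => ⟨_, hx i⟩, fun i j hij => ⟨rfl, hij⟩⟩
  by_contra! h
  choose f hf using h
  obtain ⟨i, hi⟩ := Fintype.exists_lt_card_fiber_of_mul_lt_card f (n := n - 1) (by simpa using hB)
  obtain ⟨S, hS, hSn⟩ := Finset.exists_subset_card_eq (Nat.le_of_pred_lt hi)
  obtain ⟨⟨b, i', x⟩ | p, hu, hadj⟩ := hD (.inr (i, ⟨S, hSn⟩))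
  · obtain ⟨rfl, hb⟩ := hadj
    obtain rfl := (Finset.mem_filter.1 (hS hb)).2
    exact hf b x hu
  · exact hadj

lemma le_chromaticNumber_of_pairwise_adj {V : Type*} {G : SimpleGraph V} {n : ℕ} (f : Fin n → V)
    (hf : Pairwise fun i j => G.Adj (f i) (f j)) : (n : ℕ∞) ≤ G.chromaticNumber := by
  have h : (⊤ : SimpleGraph (Fin n)).chromaticNumber ≤ G.chromaticNumber :=
    chromaticNumber_mono_of_hom ⟨f, fun h => hf h⟩
  simpa using h

lemma IsTotalDominatingSet.preimage_iso {V W : Type*} {G : SimpleGraph V} {H : SimpleGraph W}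
    (e : G ≃g H) {D : Set W} (hD : IsTotalDominatingSet H D) :
    IsTotalDominatingSet G (e ⁻¹' D) := by
  intro v
  obtain ⟨u, hu, huv⟩ := hD (e v)
  exact ⟨e.symm u, by simpa using hu, e.map_adj_iff.1 (by simpa using huv)⟩

lemma gammaTD_le_of_iso {V W : Type*} {G : SimpleGraph V} {H : SimpleGraph W} (e : G ≃g H) :
    gammaTD G ≤ gammaTD H := by
  refine le_sInf ?_
  rintro _ ⟨D, hD, rfl⟩
  refine sInf_le_of_le ⟨_, hD.preimage_iso e, rfl⟩ (chromaticNumber_mono_of_hom ?_)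
  exact ⟨fun v => ⟨e v.1, v.2⟩, fun h => e.map_adj_iff.2 h⟩

lemma gammaTD_le_chromaticNumber {V : Type*} {G : SimpleGraph V}
    (hG : IsTotalDominatingSet G Set.univ) : gammaTD G ≤ G.chromaticNumber :=
  sInf_le_of_le ⟨_, hG, rfl⟩ (chromaticNumber_mono_of_hom (Embedding.induce Set.univ).toHom)

theorem stmt3 (n : ℕ) (hn : 2 ≤ n) :
    ∃ (t : ℕ) (G : SimpleGraph (Fin t)) (d : ℕ),
      (∀ v, (G.neighborSet v).ncard = d) ∧
      G.chromaticNumber = n ∧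
      gammaTD G = n := by
  classical
  let B := Fin (n * (n - 1) + 1)
  obtain ⟨m, hm⟩ : ∃ m, ∀ b : B, {S : {S : Finset B // S.card = n} | b ∈ S.1}.ncard = m :=
    ⟨_, fun b => ncard_subsets_containing_eq n b 0⟩
  have hm0 : 0 < m := by
    obtain ⟨S, hS, -, hSn⟩ := Finset.exists_subsuperset_card_eq
      (Finset.subset_univ ({0} : Finset B)) (n := n) (by simp; lia)
      (by
        simp only [Finset.card_univ, B, Fintype.card_fin]
        exact (Nat.le_mul_of_pos_right n (by lia)).trans (Nat.le_succ _))
    rw [← hm 0, Set.ncard_pos]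
    exact ⟨⟨S, hSn⟩, hS (Finset.mem_singleton_self 0)⟩
  let H := blockGraph B n m
  have hreg : ∀ v, (H.neighborSet v).ncard = n * m := ncard_neighborSet_blockGraph hm
  have huniv : IsTotalDominatingSet H Set.univ := fun v => by
    obtain ⟨u, hu⟩ := Set.nonempty_of_ncard_ne_zero (s := H.neighborSet v) (by
      rw [hreg]
      positivity)
    exact ⟨u, trivial, hu⟩
  have hge : (n : ℕ∞) ≤ gammaTD H := by
    refine le_sInf ?_
    rintro _ ⟨D, hD, rfl⟩
    obtain ⟨f, hf⟩ := exists_clique_of_isTotalDominatingSet_blockGraph (by simp [B]) hD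
    exact le_chromaticNumber_of_pairwise_adj f hf
  have hle : H.chromaticNumber ≤ n := (blockGraph_colorable B m hn).chromaticNumber_le
  have hγ := gammaTD_le_chromaticNumber huniv
  let e := Finite.equivFin ((B × Fin n × Fin m) ⊕ (Fin n × {S : Finset B // S.card = n}))
  let φ : H.comap e.symm ≃g H := Iso.comap e.symm H
  refine ⟨_, H.comap e.symm, n * m, fun v => ?_, ?_, ?_⟩
  · rw [← hreg (φ v)]
    exact Nat.card_congr (φ.mapNeighborSet v)
  · rw [chromaticNumber_congr φ]
    exact hle.antisymm (hge.trans hγ)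
  · rw [(gammaTD_le_of_iso φ).antisymm (gammaTD_le_of_iso φ.symm)]
    exact (hγ.trans hle).antisymm hge
end

section
/- For every natural number n ≥ 2, there exists a finite regular simple graph G with γ(G) ≥ n; that is, every total dominating set D of G induces a subgraph G[D] with chromatic number at least n. In particular, γ(G) is unbounded over the class of finite regular graphs. -/
open SimpleGraph

namespace TotalDomination

/-- Every set of vertices dominating all vertices of degree `d` induces a subgraph that is not
`k`-colorable. -/
def DominationObstructs {V : Type*} (G : SimpleGraph V) (d k : ℕ) : Prop :=
  ∀ D : Set V, (∀ v, (G.neighborSet v).ncard = d → ∃ u ∈ D, G.Adj v u) →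
    ¬ (G.induce D).Colorable k

/-- Two copies of `G`, with the two copies of each vertex of degree less than `d` joined. -/
def doubling {V : Type*} (G : SimpleGraph V) (d : ℕ) : SimpleGraph (V × Bool) where
  Adj p q := (p.2 = q.2 ∧ G.Adj p.1 q.1) ∨
    (p.2 ≠ q.2 ∧ p.1 = q.1 ∧ (G.neighborSet p.1).ncard < d)
  symm := ⟨by
    rintro ⟨v, a⟩ ⟨w, b⟩ (⟨h, h'⟩ | ⟨h, h', h''⟩)
    · exact Or.inl ⟨h.symm, h'.symm⟩
    · simp only at h h' h''
      subst h'
      exact Or.inr ⟨h.symm, rfl, h''⟩⟩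
  loopless := ⟨by rintro ⟨v, a⟩ h; simp at h⟩

theorem ncard_neighborSet_doubling {V : Type*} [Finite V] (G : SimpleGraph V) (d : ℕ)
    (v : V) (a : Bool) :
    ((doubling G d).neighborSet (v, a)).ncard =
      (G.neighborSet v).ncard + if (G.neighborSet v).ncard < d then 1 else 0 := by
  have hinj : Function.Injective (fun w : V => (w, a)) := fun x y h => (Prod.ext_iff.1 h).1
  split_ifs with h
  · have : (doubling G d).neighborSet (v, a) =
        insert (v, !a) ((fun w => (w, a)) '' G.neighborSet v) := by
      ext ⟨w, b⟩
      cases a <;> cases b <;> simp [doubling, h, eq_comm]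
    rw [this, Set.ncard_insert_of_notMem (by cases a <;> simp) (Set.toFinite _),
      Set.ncard_image_of_injective _ hinj]
  · have : (doubling G d).neighborSet (v, a) = (fun w => (w, a)) '' G.neighborSet v := by
      ext ⟨w, b⟩
      cases a <;> cases b <;> simp [doubling, h]
    rw [this, Set.ncard_image_of_injective _ hinj, add_zero]

theorem DominationObstructs.doubling {V : Type*} [Finite V] {G : SimpleGraph V} {d k : ℕ}
    (h : DominationObstructs G d k) : DominationObstructs (doubling G d) d k := by
  intro D hD hcol
  refine h {v | (v, false) ∈ D} (fun v hv => ?_) ?_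
  · obtain ⟨⟨w, b⟩, hw, hadj⟩ := hD (v, false) (by simp [ncard_neighborSet_doubling, hv])
    rcases hadj with ⟨hb, hadj⟩ | ⟨-, -, hlt⟩
    · simp only at hb hadj
      subst hb
      exact ⟨w, hw, hadj⟩
    · simp only at hlt
      omega
  · obtain ⟨C⟩ := hcol
    exact ⟨Coloring.mk (fun v => C ⟨(v.1, false), v.2⟩) fun {v w} hvw =>
      C.valid (Or.inl ⟨rfl, hvw⟩)⟩

/-- A finite graph of maximum degree at most `d` can be made `d`-regular while preserving
`DominationObstructs`. -/
theorem exists_regular_dominationObstructs (d k j : ℕ) :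
    ∀ {V : Type} [Finite V] (G : SimpleGraph V), (∀ v, (G.neighborSet v).ncard ≤ d) →
      (∀ v, d ≤ (G.neighborSet v).ncard + j) → DominationObstructs G d k →
      ∃ (W : Type) (_ : Finite W) (H : SimpleGraph W),
        (∀ v, (H.neighborSet v).ncard = d) ∧ DominationObstructs H d k := by
  induction j with
  | zero => exact fun {V} hV G h1 h2 h3 => ⟨V, hV, G, fun v => le_antisymm (h1 v) (h2 v), h3⟩
  | succ j ih =>
    intro V _ G h1 h2 h3
    refine ih (TotalDomination.doubling G d) ?_ ?_ h3.doubling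
    all_goals
      rintro ⟨v, a⟩
      have h1 := h1 v
      have h2 := h2 v
      rw [ncard_neighborSet_doubling]
      split_ifs <;> omega

/-- A disjoint union of `d` cliques of size `m`, together with independent vertices `b : Fin t`,
each joined to the vertex `F b i` of the `i`-th clique for every `i`. -/
def cliqueSystem {d m t : ℕ} (F : Fin t → Fin d → Fin m) :
    SimpleGraph ((Fin d × Fin m) ⊕ Fin t) where
  Adj
    | .inl p, .inl q => p.1 = q.1 ∧ p.2 ≠ q.2
    | .inl p, .inr b => F b p.1 = p.2
    | .inr b, .inl p => F b p.1 = p.2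
    | .inr _, .inr _ => False
  symm := ⟨by
    rintro (p | b) (q | c) h
    · exact ⟨h.1.symm, h.2.symm⟩
    · exact h
    · exact h
    · exact h⟩
  loopless := ⟨by
    rintro (p | b) h
    · exact h.2 rfl
    · exact h⟩

theorem ncard_neighborSet_cliqueSystem_inr {d m t : ℕ} (F : Fin t → Fin d → Fin m) (b : Fin t) :
    ((cliqueSystem F).neighborSet (.inr b)).ncard = d := by
  have : (cliqueSystem F).neighborSet (.inr b) =
      Set.range (fun i => Sum.inl (i, F b i) : Fin d → (Fin d × Fin m) ⊕ Fin t) := by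
    ext (⟨i, x⟩ | c) <;> simp [cliqueSystem]
  rw [this, ← Set.image_univ, Set.ncard_image_of_injective _ fun i j h => by simp_all]
  simp

theorem ncard_neighborSet_cliqueSystem_inl_le {d m t : ℕ} (F : Fin t → Fin d → Fin m)
    (i : Fin d) (x : Fin m) :
    ((cliqueSystem F).neighborSet (.inl (i, x))).ncard ≤
      m + ∑ b, if F b i = x then 1 else 0 := by
  have hsub : (cliqueSystem F).neighborSet (.inl (i, x)) ⊆
      Set.range (fun y => Sum.inl (i, y) : Fin m → (Fin d × Fin m) ⊕ Fin t) ∪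
        Sum.inr '' (↑(Finset.univ.filter fun b => F b i = x) : Set (Fin t)) := by
    rintro (⟨j, y⟩ | c) h
    · left
      exact ⟨y, by rw [show i = j from h.1]⟩
    · right
      exact ⟨c, by simpa using (show F c i = x from h), rfl⟩
  refine (Set.ncard_le_ncard hsub (Set.toFinite _)).trans ((Set.ncard_union_le _ _).trans ?_)
  gcongr
  · rw [← Set.image_univ]
    exact (Set.ncard_image_le (Set.toFinite _)).trans (by simp)
  · refine (Set.ncard_image_le (Set.toFinite _)).trans ?_
    rw [Set.ncard_coe_finset, Finset.card_filter]

theorem dominationObstructs_cliqueSystem {d m t k : ℕ} [NeZero m] (F : Fin t → Fin d → Fin m)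
    (hF : ∀ s : Fin d → Fin k → Fin m, ∃ b, ∀ i c, F b i ≠ s i c) :
    DominationObstructs (cliqueSystem F) d k := by
  classical
  rintro D hD ⟨C⟩
  let s : Fin d → Fin k → Fin m := fun i c =>
    if h : ∃ x, ∃ hx : Sum.inl (i, x) ∈ D, C ⟨_, hx⟩ = c then h.choose else 0
  obtain ⟨b, hb⟩ := hF s
  obtain ⟨u, hu, hadj⟩ := hD (.inr b) (ncard_neighborSet_cliqueSystem_inr F b)
  rcases u with ⟨i, x⟩ | c
  · have hx : F b i = x := hadj
    have h : ∃ y, ∃ hy : Sum.inl (i, y) ∈ D, C ⟨_, hy⟩ = C ⟨_, hu⟩ := ⟨x, hu, rfl⟩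
    refine hb i (C ⟨_, hu⟩) ?_
    simp only [s, dif_pos h]
    obtain ⟨hy, hC⟩ := h.choose_spec
    by_contra hne
    refine C.valid (v := ⟨_, hy⟩) (w := ⟨_, hu⟩) ?_ hC
    exact ⟨rfl, fun h' => hne (hx.trans h'.symm)⟩
  · exact hadj

/-- Among the functions choosing an element of `A i` for every `i`, some function avoids
a proportion of at least `δ ^ d` of the members of a family `S`. -/
theorem exists_avoiding {d m k : ℕ} (A : Fin d → Finset (Fin m)) (δ : ℝ) (hδ : 0 ≤ δ)
    (hA : ∀ i, (A i).Nonempty) (hAk : ∀ i, δ * (A i).card ≤ (A i).card - k)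
    (S : Finset (Fin d → Fin k → Fin m)) :
    ∃ f : Fin d → Fin m, (∀ i, f i ∈ A i) ∧
      ((S.filter fun s => ∃ i c, f i = s i c).card : ℝ) ≤ (1 - δ ^ d) * S.card := by
  classical
  have hne : (Fintype.piFinset A).Nonempty := Fintype.piFinset_nonempty.2 hA
  have key : (Fintype.piFinset A).card • (δ ^ d * S.card) ≤
      ∑ f ∈ Fintype.piFinset A, ((S.filter fun s => ∀ i c, f i ≠ s i c).card : ℝ) := by
    have hswap : ∑ f ∈ Fintype.piFinset A, ((S.filter fun s => ∀ i c, f i ≠ s i c).card : ℝ) =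
        ∑ s ∈ S, (((Fintype.piFinset A).filter fun f => ∀ i c, f i ≠ s i c).card : ℝ) := by
      simp only [Finset.card_filter, Nat.cast_sum]
      exact Finset.sum_comm
    rw [hswap]
    have hs : ∀ s ∈ S, (δ ^ d * (Fintype.piFinset A).card : ℝ) ≤
        (((Fintype.piFinset A).filter fun f => ∀ i c, f i ≠ s i c).card : ℝ) := by
      intro s _
      have heq : ((Fintype.piFinset A).filter fun f => ∀ i c, f i ≠ s i c) =
          Fintype.piFinset fun i => A i \ Finset.univ.image (s i) := by
        ext f
        simp only [Finset.mem_filter, Fintype.mem_piFinset, Finset.mem_sdiff, Finset.mem_image,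
          Finset.mem_univ, true_and, not_exists, forall_and, eq_comm, ne_eq]
      rw [heq, Fintype.card_piFinset, Fintype.card_piFinset, Nat.cast_prod, Nat.cast_prod]
      calc δ ^ d * ∏ i, ((A i).card : ℝ) = ∏ i, δ * ((A i).card : ℝ) := by
            rw [Finset.prod_mul_distrib]; simp
        _ ≤ _ := by
            refine Finset.prod_le_prod (fun i _ => by positivity) fun i _ => ?_
            refine (hAk i).trans ?_
            have h1 := Finset.le_card_sdiff (Finset.univ.image (s i)) (A i)
            have h2 : (Finset.univ.image (s i)).card ≤ k :=
              Finset.card_image_le.trans (by simp)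
            have h3 : (A i).card ≤ (A i \ Finset.univ.image (s i)).card + k := by omega
            have h4 : ((A i).card : ℝ) ≤ (A i \ Finset.univ.image (s i)).card + k := by
              exact_mod_cast h3
            linarith
    have := Finset.card_nsmul_le_sum S _ _ hs
    rw [nsmul_eq_mul] at this ⊢
    linarith
  obtain ⟨f, hf, hle⟩ := Finset.exists_le_of_sum_le hne
    (show ∑ _f ∈ Fintype.piFinset A, (δ ^ d * S.card : ℝ) ≤
        ∑ f ∈ Fintype.piFinset A, ((S.filter fun s => ∀ i c, f i ≠ s i c).card : ℝ) by
      rw [Finset.sum_const]; exact key)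
  refine ⟨f, Fintype.mem_piFinset.1 hf, ?_⟩
  have hsplit := Finset.card_filter_add_card_filter_not (s := S) fun s => ∀ i c, f i ≠ s i c
  simp only [not_forall, ne_eq, not_not] at hsplit
  have hsplit' : ((S.filter fun s => ∀ i c, f i ≠ s i c).card : ℝ) +
      (S.filter fun s => ∃ i c, f i = s i c).card = S.card := by
    exact_mod_cast hsplit
  linarith

/-- Greedy selection of `t` functions, taking every value at most `2 * m` times in each coordinate,
for which few `s` are met by all the functions. -/
theorem exists_family_few_unavoided {d m k : ℕ} (hm : 0 < m) (δ : ℝ) (hδ : 0 ≤ δ) (hδ1 : δ ≤ 1)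
    (hk : 2 * k ≤ (1 - δ) * m) (t : ℕ) (ht : t ≤ m * m) :
    ∃ F : Fin t → Fin d → Fin m,
      (∀ i x, (∑ b, if F b i = x then 1 else 0) ≤ 2 * m) ∧
      ((Finset.univ.filter fun s : Fin d → Fin k → Fin m =>
        ∀ b, ∃ i c, F b i = s i c).card : ℝ) ≤ (1 - δ ^ d) ^ t * ((m : ℝ) ^ k) ^ d := by
  classical
  induction t with
  | zero => exact ⟨Fin.elim0, by simp, by simp⟩
  | succ t ih =>
    obtain ⟨F, hload, hcard⟩ := ih (by omega)
    set load : Fin d → Fin m → ℕ := fun i x => ∑ b, if F b i = x then 1 else 0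
    let A : Fin d → Finset (Fin m) := fun i => Finset.univ.filter fun x => load i x < 2 * m
    have hAcard : ∀ i, m ≤ 2 * (A i).card := by
      intro i
      have htotal : ∑ x, load i x = t := by
        simp only [load]
        rw [Finset.sum_comm]
        simp
      have hfull : (Finset.univ.filter fun x => ¬ load i x < 2 * m).card * (2 * m) ≤ t := by
        rw [← htotal, ← smul_eq_mul]
        refine (Finset.card_nsmul_le_sum _ (load i) _ fun x hx => ?_).trans
          (Finset.sum_le_sum_of_subset (Finset.subset_univ _))
        simpa using hx
      have hsplit := Finset.card_filter_add_card_filter_not (s := (Finset.univ : Finset (Fin m)))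
        fun x => load i x < 2 * m
      rw [Finset.card_univ, Fintype.card_fin] at hsplit
      have h2 : (2 * (Finset.univ.filter fun x => ¬ load i x < 2 * m).card) * m ≤ m * m := by
        linarith
      have := Nat.le_of_mul_le_mul_right h2 hm
      change m ≤ 2 * (Finset.univ.filter fun x => load i x < 2 * m).card
      omega
    obtain ⟨f, hfA, hf⟩ := exists_avoiding A δ hδ
      (fun i => Finset.card_pos.1 (by have := hAcard i; omega))
      (fun i => by
        have : (m : ℝ) ≤ 2 * (A i).card := by exact_mod_cast hAcard i
        nlinarith)
      (Finset.univ.filter fun s : Fin d → Fin k → Fin m => ∀ b, ∃ i c, F b i = s i c)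
    refine ⟨Fin.cons f F, fun i x => ?_, ?_⟩
    · rw [Fin.sum_univ_succ]
      simp only [Fin.cons_zero, Fin.cons_succ]
      have h1 : load i x ≤ 2 * m := hload i x
      change (if f i = x then 1 else 0) + load i x ≤ 2 * m
      split_ifs with h
      · have h2 : load i (f i) < 2 * m := by simpa [A] using hfA i
        rw [h] at h2
        omega
      · omega
    · have hδd : 0 ≤ 1 - δ ^ d := sub_nonneg.2 (pow_le_one₀ hδ hδ1)
      have heq : (Finset.univ.filter fun s : Fin d → Fin k → Fin m =>
          ∀ b, ∃ i c, (Fin.cons f F : Fin (t + 1) → Fin d → Fin m) b i = s i c) =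
          (Finset.univ.filter fun s : Fin d → Fin k → Fin m =>
            ∀ b, ∃ i c, F b i = s i c).filter fun s => ∃ i c, f i = s i c := by
        ext s
        simp [Fin.forall_fin_succ, and_comm]
      rw [heq, pow_succ']
      calc _ ≤ _ := hf
        _ ≤ _ := by rw [mul_assoc]; gcongr

/-- Some `m` admits a choice of `δ` for which the greedy selection leaves nothing unavoided. -/
theorem exists_parameters {k : ℕ} (hk : 0 < k) :
    ∃ (m : ℕ) (δ : ℝ), 0 < m ∧ 0 ≤ δ ∧ δ ≤ 1 ∧ 2 * k ≤ (1 - δ) * m ∧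
      (1 - δ ^ (3 * m)) ^ (m * m) * ((m : ℝ) ^ k) ^ (3 * m) < 1 := by
  set ρ : ℝ := 1 - (1 / 2) ^ (12 * k)
  have hρ1 : ρ < 1 := by simp [ρ]
  have hρ0 : 0 ≤ ρ := sub_nonneg.2 (pow_le_one₀ (by norm_num) (by norm_num))
  have hlim := tendsto_pow_const_mul_const_pow_of_abs_lt_one (3 * k)
    (show |ρ| < 1 by rwa [abs_of_nonneg hρ0])
  obtain ⟨N, hN⟩ := Filter.eventually_atTop.1 (hlim.eventually_lt_const one_pos)
  set h := N + 1
  have hh : (1 : ℝ) ≤ h := by simp [h]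
  set δ : ℝ := 1 - 1 / (2 * h)
  have hinv : 1 / (2 * (h : ℝ)) ≤ 1 / 2 := by
    rw [div_le_div_iff₀ (by positivity) (by norm_num)]; linarith
  have hinv0 : 0 ≤ 1 / (2 * (h : ℝ)) := by positivity
  have hδ0 : 0 ≤ δ := by simp only [δ]; linarith
  have hδ1 : δ ≤ 1 := by simp only [δ]; linarith
  refine ⟨4 * k * h, δ, by positivity, hδ0, hδ1, ?_, ?_⟩
  · simp only [δ]
    push_cast
    apply le_of_eq
    field_simp
    ring
  · set m := 4 * k * h with hm
    have hhalf : 1 / 2 ≤ δ ^ h := by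
      have := one_add_mul_le_pow (a := -(1 / (2 * (h : ℝ)))) (by linarith) h
      have e : 1 + (h : ℝ) * -(1 / (2 * (h : ℝ))) = 1 / 2 := by field_simp; ring
      rw [e] at this
      simpa [δ, sub_eq_add_neg] using this
    have hδm : (1 / 2 : ℝ) ^ (12 * k) ≤ δ ^ (3 * m) := by
      rw [show 3 * m = h * (12 * k) by rw [hm]; ring, pow_mul δ]
      exact pow_le_pow_left₀ (by norm_num) hhalf _
    have hlt := hN m ((Nat.le_succ N).trans (Nat.le_mul_of_pos_left h (by positivity)))
    have hbase : 0 ≤ 1 - δ ^ (3 * m) := sub_nonneg.2 (pow_le_one₀ hδ0 hδ1)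
    have hle : 1 - δ ^ (3 * m) ≤ ρ := sub_le_sub_left hδm 1
    calc (1 - δ ^ (3 * m)) ^ (m * m) * ((m : ℝ) ^ k) ^ (3 * m)
        ≤ ρ ^ (m * m) * ((m : ℝ) ^ k) ^ (3 * m) := by
          gcongr
      _ = ((m : ℝ) ^ (3 * k) * ρ ^ m) ^ m := by
          rw [mul_pow, ← pow_mul, ← pow_mul, ← pow_mul, mul_comm]
          ring_nf
      _ < 1 := pow_lt_one₀ (by positivity) hlt (by positivity)

theorem exists_regular_fin {k : ℕ} (hk : 0 < k) :
    ∃ (t : ℕ) (G : SimpleGraph (Fin t)) (d : ℕ),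
      (∀ v, (G.neighborSet v).ncard = d) ∧
      ∀ D : Set (Fin t), IsTotalDominatingSet G D → ¬ (G.induce D).Colorable k := by
  classical
  obtain ⟨m, δ, hm, hδ0, hδ1, hmk, hlt⟩ := exists_parameters hk
  obtain ⟨F, hload, hcard⟩ := exists_family_few_unavoided (d := 3 * m) hm δ hδ0 hδ1 hmk _ le_rfl
  have hzero := hcard.trans_lt hlt
  rw [Nat.cast_lt_one, Finset.card_eq_zero, Finset.filter_eq_empty_iff] at hzero
  have : NeZero m := ⟨hm.ne'⟩
  have hobs : DominationObstructs (cliqueSystem F) (3 * m) k :=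
    dominationObstructs_cliqueSystem F fun s => by
      simpa using hzero (Finset.mem_univ s)
  obtain ⟨W, _, H, hreg, hH⟩ := exists_regular_dominationObstructs (3 * m) k (3 * m)
    (cliqueSystem F)
    (by
      rintro (⟨i, x⟩ | b)
      · have := ncard_neighborSet_cliqueSystem_inl_le F i x
        have := hload i x
        omega
      · exact (ncard_neighborSet_cliqueSystem_inr F b).le)
    (fun v => Nat.le_add_left _ _) hobs
  let e := Finite.equivFin W
  refine ⟨Nat.card W, H.comap e.symm, 3 * m, fun v => ?_, fun D hD hcol => ?_⟩
  · rw [← hreg (e.symm v), ← Set.ncard_image_of_injective (H.neighborSet (e.symm v)) e.injective]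
    congr 1
    ext w
    simp [Equiv.image_eq_preimage_symm]
  · refine hH (e ⁻¹' D) (fun v _ => ?_) ?_
    · obtain ⟨u, hu, hadj⟩ := hD (e v)
      exact ⟨e.symm u, by simpa using hu, by simpa using hadj⟩
    · obtain ⟨C⟩ := hcol
      exact ⟨Coloring.mk (fun v => C ⟨e v.1, v.2⟩) fun {v w} hvw =>
        C.valid (by simpa using hvw)⟩

end TotalDomination

theorem stmt12 (n : ℕ) (hn : 2 ≤ n) :
    ∃ (t : ℕ) (G : SimpleGraph (Fin t)) (d : ℕ),
      (∀ v, (G.neighborSet v).ncard = d) ∧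
      (n : ℕ∞) ≤ gammaTD G ∧
      ∀ D : Set (Fin t), IsTotalDominatingSet G D →
        (n : ℕ∞) ≤ (G.induce D).chromaticNumber := by
  obtain ⟨t, G, d, hreg, hG⟩ := TotalDomination.exists_regular_fin (k := n - 1) (by omega)
  have hχ : ∀ D : Set (Fin t), IsTotalDominatingSet G D →
      (n : ℕ∞) ≤ (G.induce D).chromaticNumber := by
    intro D hD
    by_contra! hlt
    refine hG D hD (chromaticNumber_le_iff_colorable.1
      ((ENat.lt_add_one_iff (ENat.natCast_ne_top _)).1 ?_))
    have : ((n - 1 : ℕ) : ℕ∞) + 1 = n := by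
      exact_mod_cast Nat.sub_add_cancel (show 1 ≤ n by omega)
    rwa [this]
  refine ⟨t, G, d, hreg, le_sInf ?_, hχ⟩
  rintro _ ⟨D, hD, rfl⟩
  exact hχ D hD
end
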